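/- arXiv:2601.08271 — 2 statements merged into one kernel-verified Lean document; each statement's English description precedes it below -/
import Mathlib

section
/- Hessian stability implies empirical irrepresentability (operator perturbation form): Let X and Y be real Banach spaces. Let A : X → X be a continuous linear equivalence with ‖A⁻¹‖ ≤ κ for some κ > 0, and let B : X → Y be a continuous linear map such that ‖B ∘ A⁻¹‖ ≤ 1 − α for some α ∈ (0, 1]. Let E_A : X → X and E_B : X → Y be continuous linear maps with ‖E_A‖ ≤ η and ‖E_B‖ ≤ η, where 0 ≤ η ≤ min(1/(2κ), α/(8κ)). Then A + E_A is a continuous linear equivalence (invertible), and ‖(B + E_B) ∘ (A + E_A)⁻¹‖ ≤ 1 − α/2. -/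
/-- A perturbation `A + E` of a continuous linear equivalence is again one when `‖E ∘ A⁻¹‖ < 1`. -/
theorem ContinuousLinearEquiv.exists_coe_eq_add
    {X : Type*} [NormedAddCommGroup X] [NormedSpace ℝ X] [CompleteSpace X]
    (A : X ≃L[ℝ] X) (E : X →L[ℝ] X) (h : ‖E.comp (A.symm : X →L[ℝ] X)‖ < 1) :
    ∃ A' : X ≃L[ℝ] X, (A' : X →L[ℝ] X) = (A : X →L[ℝ] X) + E := by
  have h' : ‖-(E.comp (A.symm : X →L[ℝ] X))‖ < 1 := by rwa [norm_neg]
  refine ⟨A.trans (ContinuousLinearEquiv.unitsEquiv ℝ X (Units.oneSub _ h')), ?_⟩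
  ext x
  simp

/-- If `A' = A + E`, then `‖C ∘ A'⁻¹‖ ≤ ‖C ∘ A⁻¹‖ + ‖C ∘ A'⁻¹‖ * ‖E ∘ A⁻¹‖`. -/
theorem ContinuousLinearEquiv.norm_comp_symm_le_of_coe_eq_add
    {X Y : Type*} [NormedAddCommGroup X] [NormedSpace ℝ X]
    [NormedAddCommGroup Y] [NormedSpace ℝ Y]
    {A A' : X ≃L[ℝ] X} {E : X →L[ℝ] X} (h : (A' : X →L[ℝ] X) = (A : X →L[ℝ] X) + E)
    (C : X →L[ℝ] Y) :
    ‖C.comp (A'.symm : X →L[ℝ] X)‖ ≤ ‖C.comp (A.symm : X →L[ℝ] X)‖ +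
      ‖C.comp (A'.symm : X →L[ℝ] X)‖ * ‖E.comp (A.symm : X →L[ℝ] X)‖ := by
  have key : C.comp (A'.symm : X →L[ℝ] X) = C.comp (A.symm : X →L[ℝ] X) -
      (C.comp (A'.symm : X →L[ℝ] X)).comp (E.comp (A.symm : X →L[ℝ] X)) := by
    ext x
    have hx : A' (A.symm x) = x + E (A.symm x) := by
      simpa using DFunLike.congr_fun h (A.symm x)
    have hx' : A.symm x = A'.symm x + A'.symm (E (A.symm x)) := by
      rw [← map_add, ← hx, A'.symm_apply_apply]
    simpa [eq_sub_iff_add_eq] using (congrArg C hx').symm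
  calc ‖C.comp (A'.symm : X →L[ℝ] X)‖
      = ‖C.comp (A.symm : X →L[ℝ] X) -
          (C.comp (A'.symm : X →L[ℝ] X)).comp (E.comp (A.symm : X →L[ℝ] X))‖ :=
        congrArg norm key
    _ ≤ _ := (norm_sub_le _ _).trans <| by
        gcongr
        exact ContinuousLinearMap.opNorm_comp_le _ _

/-- **Hessian stability implies empirical irrepresentability** (operator perturbation form):
a small perturbation of an invertible operator `A` remains invertible, and the irrepresentability
norm bound `‖B ∘ A⁻¹‖ ≤ 1 - α` degrades only to `1 - α/2`. -/
theorem hessian_stability_irrepresentability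
    {X Y : Type*} [NormedAddCommGroup X] [NormedSpace ℝ X] [CompleteSpace X]
    [NormedAddCommGroup Y] [NormedSpace ℝ Y] [CompleteSpace Y]
    (A : X ≃L[ℝ] X) (κ : ℝ) (hκ : 0 < κ)
    (hAinv : ‖(A.symm : X →L[ℝ] X)‖ ≤ κ)
    (B : X →L[ℝ] Y) (α : ℝ) (hα : α ∈ Set.Ioc (0 : ℝ) 1)
    (hBA : ‖B.comp (A.symm : X →L[ℝ] X)‖ ≤ 1 - α)
    (EA : X →L[ℝ] X) (EB : X →L[ℝ] Y) (η : ℝ) (hη0 : 0 ≤ η)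
    (hEA : ‖EA‖ ≤ η) (hEB : ‖EB‖ ≤ η)
    (hηsmall : η ≤ min (1 / (2 * κ)) (α / (8 * κ))) :
    ∃ A' : X ≃L[ℝ] X, (A' : X →L[ℝ] X) = (A : X →L[ℝ] X) + EA ∧
      ‖(B + EB).comp (A'.symm : X →L[ℝ] X)‖ ≤ 1 - α / 2 := by
  obtain ⟨hα0, hα1⟩ := hα
  have hηκ : η * κ ≤ α / 8 := by
    have := (le_div_iff₀ (by positivity)).mp (hηsmall.trans (min_le_right _ _))
    linarith
  have hEA' : ‖EA.comp (A.symm : X →L[ℝ] X)‖ ≤ α / 8 :=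
    (ContinuousLinearMap.opNorm_comp_le _ _).trans <|
      (mul_le_mul hEA hAinv (norm_nonneg _) hη0).trans hηκ
  have hEB' : ‖EB.comp (A.symm : X →L[ℝ] X)‖ ≤ α / 8 :=
    (ContinuousLinearMap.opNorm_comp_le _ _).trans <|
      (mul_le_mul hEB hAinv (norm_nonneg _) hη0).trans hηκ
  obtain ⟨A', hA'⟩ := A.exists_coe_eq_add EA (by linarith)
  refine ⟨A', hA', ?_⟩
  have hM := ContinuousLinearEquiv.norm_comp_symm_le_of_coe_eq_add hA' (B + EB)
  have hN : ‖(B + EB).comp (A.symm : X →L[ℝ] X)‖ ≤ 1 - α + α / 8 := by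
    rw [ContinuousLinearMap.add_comp]
    exact (norm_add_le _ _).trans (add_le_add hBA hEB')
  have hMF := mul_le_mul_of_nonneg_left hEA' (norm_nonneg ((B + EB).comp (A'.symm : X →L[ℝ] X)))
  by_contra! hlt
  nlinarith
end

section
/- Exponential packing of the unit sphere (used in the dense lower bound): For every natural number d ≥ 1 there exists a finite set P of vectors in EuclideanSpace ℝ (Fin d) such that ‖v‖ = 1 for every v ∈ P, ‖v − v'‖ ≥ 1/2 for all distinct v, v' ∈ P, and the cardinality of P is at least exp(d/12). -/
/-- Scaling a unit vector down to length `r ≤ 1` keeps it within `4 / 7` of `(4 / 7) • p`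
whenever it is within `1 / 2` of the unit vector `p`. -/
lemma norm_smul_sub_smul_le {E : Type*} [NormedAddCommGroup E] [InnerProductSpace ℝ E]
    {u p : E} (hu : ‖u‖ = 1) (hp : ‖p‖ = 1) (h : ‖u - p‖ ≤ 1 / 2)
    {r : ℝ} (hr₀ : 0 ≤ r) (hr₁ : r ≤ 1) :
    ‖r • u - (4 / 7 : ℝ) • p‖ ≤ 4 / 7 := by
  have hsub := norm_sub_sq_real u p
  have hsmul := norm_sub_sq_real (r • u) ((4 / 7 : ℝ) • p)
  rw [hu, hp] at hsub
  rw [norm_smul, norm_smul, hu, hp, real_inner_smul_left, real_inner_smul_right,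
    Real.norm_of_nonneg hr₀, Real.norm_of_nonneg (by norm_num)] at hsmul
  have hinner : 7 / 8 ≤ inner ℝ u p := by nlinarith [norm_nonneg (u - p)]
  refine le_of_sq_le_sq ?_ (by norm_num)
  nlinarith [mul_le_mul_of_nonneg_left hinner hr₀, mul_nonneg hr₀ (sub_nonneg.2 hr₁)]

/-- Fewer than `(7 / 4) ^ dim E` balls of radius `1 / 2` centred on the unit sphere of `E`
do not cover it. -/
lemma exists_unit_vector_far_of_card_lt {E : Type*} [NormedAddCommGroup E]
    [InnerProductSpace ℝ E] [FiniteDimensional ℝ E] [Nontrivial E] (P : Finset E)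
    (hP : ∀ v ∈ P, ‖v‖ = 1) (hcard : (P.card : ℝ) < (7 / 4) ^ Module.finrank ℝ E) :
    ∃ u : E, ‖u‖ = 1 ∧ ∀ p ∈ P, 1 / 2 < ‖u - p‖ := by
  by_contra! hfar
  let _ : MeasurableSpace E := borel E
  have : BorelSpace E := ⟨rfl⟩
  let μ : MeasureTheory.Measure E := MeasureTheory.Measure.addHaar
  have hcover : Metric.closedBall (0 : E) 1 ⊆
      ⋃ p ∈ P, Metric.closedBall ((4 / 7 : ℝ) • p) (4 / 7) := by
    intro x hx
    obtain ⟨u, hu, hxu⟩ : ∃ u : E, ‖u‖ = 1 ∧ ‖x‖ • u = x := by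
      rcases eq_or_ne x 0 with rfl | hx0
      · obtain ⟨u, hu⟩ := exists_norm_eq E zero_le_one
        exact ⟨u, hu, by simp⟩
      · exact ⟨‖x‖⁻¹ • x, norm_smul_inv_norm (𝕜 := ℝ) hx0,
          smul_inv_smul₀ (norm_ne_zero_iff.2 hx0) x⟩
    obtain ⟨p, hpP, hup⟩ := hfar u hu
    refine Set.mem_iUnion₂.2 ⟨p, hpP, ?_⟩
    rw [mem_closedBall_iff_norm, ← hxu]
    exact norm_smul_sub_smul_le hu (hP p hpP) hup (norm_nonneg x) (by simpa using hx)
  have hfin : μ (⋃ p ∈ P, Metric.closedBall ((4 / 7 : ℝ) • p) (4 / 7)) ≠ ⊤ :=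
    (MeasureTheory.measure_biUnion_lt_top P.finite_toSet
      fun _ _ => MeasureTheory.measure_closedBall_lt_top).ne
  have hvol := (MeasureTheory.measureReal_mono hcover hfin).trans
    (MeasureTheory.measureReal_biUnion_finset_le (μ := μ) P _)
  have hpos : 0 < μ.real (Metric.closedBall (0 : E) 1) :=
    ENNReal.toReal_pos (Metric.measure_closedBall_pos μ 0 one_pos).ne'
      MeasureTheory.measure_closedBall_lt_top.ne
  simp only [MeasureTheory.Measure.addHaar_real_closedBall' μ _
    (show (0 : ℝ) ≤ 4 / 7 by norm_num), Finset.sum_const, nsmul_eq_mul] at hvol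
  rw [← mul_assoc] at hvol
  have hone : 1 ≤ (P.card : ℝ) * (4 / 7) ^ Module.finrank ℝ E :=
    le_of_mul_le_mul_right (by rwa [one_mul]) hpos
  have hlt := mul_lt_mul_of_pos_right hcard
    (show (0 : ℝ) < (4 / 7) ^ Module.finrank ℝ E by positivity)
  rw [← mul_pow] at hlt
  norm_num at hlt
  linarith

/-- The unit sphere of `E` contains a `1 / 2`-separated set of each size up to
`⌈(7 / 4) ^ dim E⌉`. -/
lemma exists_separated_finset_card_eq {E : Type*} [NormedAddCommGroup E]
    [InnerProductSpace ℝ E] [FiniteDimensional ℝ E] [Nontrivial E] (n : ℕ)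
    (hn : n ≤ ⌈(7 / 4 : ℝ) ^ Module.finrank ℝ E⌉₊) :
    ∃ P : Finset E, (∀ v ∈ P, ‖v‖ = 1) ∧
      (∀ v ∈ P, ∀ v' ∈ P, v ≠ v' → 1 / 2 ≤ ‖v - v'‖) ∧ P.card = n := by
  classical
  induction n with
  | zero => exact ⟨∅, by simp⟩
  | succ n ih =>
    obtain ⟨P, hP, hsep, rfl⟩ := ih (Nat.le_of_succ_le hn)
    obtain ⟨u, hu, hfar⟩ := exists_unit_vector_far_of_card_lt P hP (Nat.lt_ceil.1 hn)
    have huP : u ∉ P := fun h => by simpa using (hfar u h).not_ge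
    refine ⟨insert u P, Finset.forall_mem_insert _ _ _ |>.2 ⟨hu, hP⟩, ?_,
      Finset.card_insert_of_notMem huP⟩
    intro v hv v' hv' hne
    rcases Finset.mem_insert.1 hv with rfl | hvP <;>
      rcases Finset.mem_insert.1 hv' with rfl | hvP'
    · exact absurd rfl hne
    · exact (hfar v' hvP').le
    · rw [norm_sub_rev]
      exact (hfar v hvP).le
    · exact hsep v hvP v' hvP' hne

/-- **Exponential packing of the unit sphere** (used in the dense lower bound). -/
theorem sphere_packing_exponential (d : ℕ) (hd : 1 ≤ d) :
    ∃ P : Finset (EuclideanSpace ℝ (Fin d)),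
      (∀ v ∈ P, ‖v‖ = 1) ∧
      (∀ v ∈ P, ∀ v' ∈ P, v ≠ v' → 1 / 2 ≤ ‖v - v'‖) ∧
      Real.exp ((d : ℝ) / 12) ≤ (P.card : ℝ) := by
  have : Nonempty (Fin d) := ⟨⟨0, hd⟩⟩
  obtain ⟨P, hP, hsep, hcard⟩ :=
    exists_separated_finset_card_eq (E := EuclideanSpace ℝ (Fin d)) _ le_rfl
  refine ⟨P, hP, hsep, ?_⟩
  have hexp : Real.exp (1 / 12) ≤ 7 / 4 := by
    have hneg := Real.add_one_le_exp (-(1 / 12 : ℝ))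
    have hmul : Real.exp (1 / 12) * Real.exp (-(1 / 12)) = 1 := by
      rw [← Real.exp_add, add_neg_cancel, Real.exp_zero]
    nlinarith [Real.exp_pos (1 / 12)]
  calc Real.exp ((d : ℝ) / 12) = Real.exp (1 / 12) ^ d := by
        rw [← Real.exp_nat_mul, mul_one_div]
    _ ≤ (7 / 4) ^ d := pow_le_pow_left₀ (Real.exp_pos _).le hexp d
    _ ≤ (P.card : ℝ) := by
        rw [hcard, finrank_euclideanSpace_fin]
        exact Nat.le_ceil _
end
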